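/- arXiv:0804.2112 — 2 statements merged into one kernel-verified Lean document; each statement's English description precedes it below -/
import Mathlib

section
/- Let B > 0, ε > 0, D > 0 and t be given, let P : ℕ → ℝ satisfy P(0) = 0, P(i) ≤ P(i+1) for all 0 ≤ i ≤ t, and P(t+1) < D, and let D₁ : ℕ → ℝ satisfy D₁(0) ≤ exp(Bε²) and, for every 0 ≤ i ≤ t, D₁(i+1) ≤ D₁(i) · (1 + Bε(1+ε) · (P(i+1) − P(i)) / (D − P(i))). If exp(ε(B−1)) < D₁(t+1), then ε(B−1) < Bε² + Bε(1+ε) · ln(D / (D − P(t+1))). -/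
theorem div_le_log_div_sub_log_div {D p q : ℝ} (hD : 0 < D) (hp : p < D) (hq : q < D) :
    (q - p) / (D - p) ≤ Real.log (D / (D - q)) - Real.log (D / (D - p)) := by
  have hp' : 0 < D - p := sub_pos.2 hp
  have hq' : 0 < D - q := sub_pos.2 hq
  have h := Real.one_sub_inv_le_log_of_pos (div_pos hp' hq')
  rw [Real.log_div hp'.ne' hq'.ne'] at h
  rw [Real.log_div hD.ne' hq'.ne', Real.log_div hD.ne' hp'.ne']
  have heq : 1 - ((D - p) / (D - q))⁻¹ = (q - p) / (D - p) := by
    field_simp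
    ring
  linarith

theorem le_exp_add_mul_log_of_recursion {C D a : ℝ} (hC : 0 ≤ C) (hD : 0 < D) {n : ℕ}
    {P D₁ : ℕ → ℝ} (hP0 : P 0 = 0) (hPmono : ∀ i < n, P i ≤ P (i + 1))
    (hPD : P n < D) (hD10 : D₁ 0 ≤ Real.exp a)
    (hrec : ∀ i < n, D₁ (i + 1) ≤ D₁ i * (1 + C * (P (i + 1) - P i) / (D - P i))) :
    D₁ n ≤ Real.exp (a + C * Real.log (D / (D - P n))) := by
  induction n with
  | zero => simpa [hP0, hD.ne'] using hD10
  | succ n ih =>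
    have hstep := hPmono n n.lt_succ_self
    have hPn : P n < D := hstep.trans_lt hPD
    have ih := ih (fun i hi => hPmono i (by lia)) hPn (fun i hi => hrec i (by lia))
    have hx : 0 ≤ C * (P (n + 1) - P n) / (D - P n) :=
      div_nonneg (mul_nonneg hC (sub_nonneg.2 hstep)) (sub_pos.2 hPn).le
    have hlog := mul_le_mul_of_nonneg_left (div_le_log_div_sub_log_div hD hPn hPD) hC
    rw [← mul_div_assoc] at hlog
    calc
      D₁ (n + 1) ≤ D₁ n * (1 + C * (P (n + 1) - P n) / (D - P n)) := hrec n n.lt_succ_self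
      _ ≤ Real.exp (a + C * Real.log (D / (D - P n))) *
          Real.exp (C * (P (n + 1) - P n) / (D - P n)) := by
        refine mul_le_mul ih ?_ (by positivity) (Real.exp_nonneg _)
        linarith [Real.add_one_le_exp (C * (P (n + 1) - P n) / (D - P n))]
      _ ≤ Real.exp (a + C * Real.log (D / (D - P (n + 1)))) := by
        rw [← Real.exp_add]
        exact Real.exp_le_exp.2 (by linarith)

theorem ufp_approx_recursion (B ε D : ℝ) (hB : 0 < B) (hε : 0 < ε) (hD : 0 < D)
    (t : ℕ) (P D₁ : ℕ → ℝ)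
    (hP0 : P 0 = 0)
    (hPmono : ∀ i ≤ t, P i ≤ P (i + 1))
    (hPD : P (t + 1) < D)
    (hD10 : D₁ 0 ≤ Real.exp (B * ε ^ 2))
    (hrec : ∀ i ≤ t, D₁ (i + 1) ≤
      D₁ i * (1 + B * ε * (1 + ε) * (P (i + 1) - P i) / (D - P i)))
    (hterm : Real.exp (ε * (B - 1)) < D₁ (t + 1)) :
    ε * (B - 1) < B * ε ^ 2 +
      B * ε * (1 + ε) * Real.log (D / (D - P (t + 1))) := by
  exact Real.exp_lt_exp.1 <| hterm.trans_le <|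
    le_exp_add_mul_log_of_recursion (by positivity) hD hP0
      (fun i hi => hPmono i (Nat.le_of_lt_succ hi)) hPD hD10
      (fun i hi => hrec i (Nat.le_of_lt_succ hi))
end

section
/- Let B > 0, ε > 0, D > 0 and t be given, let P : ℕ → ℝ satisfy P(0) = 0, and let D₁ : ℕ → ℝ satisfy D₁(0) ≤ exp(Bε²) and, for every 0 ≤ i ≤ t, D₁(i+1) ≤ D₁(i) · exp(Bε(1+ε) · (P(i+1) − P(i)) / D). If exp(ε(B−1)) < D₁(t+1), then (ε(B−1) − Bε²) / (Bε(1+ε)) < P(t+1) / D. -/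
/-- Telescoping of a multiplicative recursion whose factors are exponentials of increments. -/
theorem le_mul_exp_sub_of_le_mul_exp_sub (u f : ℕ → ℝ) (n : ℕ)
    (h : ∀ i < n, u (i + 1) ≤ u i * Real.exp (f (i + 1) - f i)) :
    u n ≤ u 0 * Real.exp (f n - f 0) := by
  induction n with
  | zero => simp
  | succ n ih =>
    calc u (n + 1) ≤ u n * Real.exp (f (n + 1) - f n) := h n n.lt_succ_self
      _ ≤ u 0 * Real.exp (f n - f 0) * Real.exp (f (n + 1) - f n) := by
        gcongr
        exact ih fun i hi => h i (hi.trans n.lt_succ_self)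
      _ = u 0 * Real.exp (f (n + 1) - f 0) := by
        rw [mul_assoc, ← Real.exp_add]
        ring_nf

theorem ufp_repeat_recursion (B ε D : ℝ) (hB : 0 < B) (hε : 0 < ε) (hD : 0 < D)
    (t : ℕ) (P D₁ : ℕ → ℝ)
    (hP0 : P 0 = 0)
    (hD10 : D₁ 0 ≤ Real.exp (B * ε ^ 2))
    (hrec : ∀ i ≤ t, D₁ (i + 1) ≤
      D₁ i * Real.exp (B * ε * (1 + ε) * (P (i + 1) - P i) / D))
    (hterm : Real.exp (ε * (B - 1)) < D₁ (t + 1)) :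
    (ε * (B - 1) - B * ε ^ 2) / (B * ε * (1 + ε)) < P (t + 1) / D := by
  have htel := le_mul_exp_sub_of_le_mul_exp_sub D₁
    (fun i => B * ε * (1 + ε) * P i / D) (t + 1) fun i hi => by
      simpa only [mul_sub, sub_div] using hrec i (Nat.lt_succ_iff.mp hi)
  simp only [hP0, mul_zero, zero_div, sub_zero] at htel
  have hexp : Real.exp (ε * (B - 1)) <
      Real.exp (B * ε ^ 2 + B * ε * (1 + ε) * P (t + 1) / D) := by
    rw [Real.exp_add]
    exact hterm.trans_le (htel.trans (by gcongr))
  have hlt := Real.exp_lt_exp.mp hexp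
  rw [div_lt_iff₀ (by positivity), mul_comm (P (t + 1) / D), ← mul_div_assoc]
  linarith
end
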